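/- arXiv:0901.1308 — 7 statements merged into one kernel-verified Lean document; each statement's English description precedes it below -/
import Mathlib

section
/- Let α > 1 and let u be measurable with u ≥ −1 (p·μ)-a.e. and ∫ |u|^α p dμ < ∞. Then ∫ |(1 + u) log(1 + u)| p dμ < ∞ (with the convention (1+u)log(1+u) = 0 where u = −1); that is, L^α(p·μ) embeds into the x log x class at p. -/
open MeasureTheory

/-- The function `t ↦ |t log t|` is dominated by `1 + |t| ^ α / (α - 1)` for every `α > 1`. -/
theorem abs_mul_log_le_one_add_rpow {α : ℝ} (hα : 1 < α) (t : ℝ) :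
    |t * Real.log t| ≤ 1 + |t| ^ α / (α - 1) := by
  have hα' : 0 < α - 1 := sub_pos.2 hα
  rcases eq_or_ne t 0 with rfl | ht
  · simp only [zero_mul, abs_zero]
    positivity
  have hs : 0 < |t| := abs_pos.2 ht
  rw [abs_mul, ← Real.log_abs t]
  rcases le_total |t| 1 with h1 | h1
  · have h := Real.abs_log_mul_self_lt |t| hs h1
    rw [abs_mul, abs_abs, mul_comm] at h
    have : 0 ≤ |t| ^ α / (α - 1) := by positivity
    linarith
  · rw [abs_of_nonneg (Real.log_nonneg h1)]
    calc |t| * Real.log |t| ≤ |t| * (|t| ^ (α - 1) / (α - 1)) := by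
          gcongr
          exact Real.log_le_rpow_div hs.le hα'
      _ = |t| ^ α / (α - 1) := by
          rw [← mul_div_assoc, mul_comm, ← Real.rpow_add_one hs.ne', sub_add_cancel]
      _ ≤ 1 + |t| ^ α / (α - 1) := by linarith

theorem abs_one_add_rpow_le {α : ℝ} (hα : 0 ≤ α) (v : ℝ) :
    |1 + v| ^ α ≤ 2 ^ α * (1 + |v| ^ α) := by
  have hv : 0 ≤ |v| ^ α := by positivity
  have habs : |1 + v| ≤ 1 + |v| := by simpa using abs_add_le 1 v
  rcases le_total |v| 1 with h | h
  · calc |1 + v| ^ α ≤ 2 ^ α := by gcongr; linarith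
      _ ≤ 2 ^ α * (1 + |v| ^ α) := le_mul_of_one_le_right (by positivity) (by linarith)
  · calc |1 + v| ^ α ≤ (2 * |v|) ^ α := by gcongr; linarith
      _ = 2 ^ α * |v| ^ α := Real.mul_rpow zero_le_two (abs_nonneg v)
      _ ≤ 2 ^ α * (1 + |v| ^ α) := by gcongr; linarith

theorem abs_one_add_mul_log_le {α : ℝ} (hα : 1 < α) (v : ℝ) :
    |(1 + v) * Real.log (1 + v)| ≤ (1 + 2 ^ α / (α - 1)) * (1 + |v| ^ α) := by
  have hα' : 0 < α - 1 := sub_pos.2 hα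
  have hv : 0 ≤ |v| ^ α := by positivity
  calc |(1 + v) * Real.log (1 + v)| ≤ 1 + |1 + v| ^ α / (α - 1) :=
        abs_mul_log_le_one_add_rpow hα _
    _ ≤ (1 + |v| ^ α) + 2 ^ α * (1 + |v| ^ α) / (α - 1) := by
        gcongr
        · linarith
        · exact abs_one_add_rpow_le (by linarith) v
    _ = (1 + 2 ^ α / (α - 1)) * (1 + |v| ^ α) := by ring

/-- `L^α(p·μ)`, `α > 1`, embeds into the `x log x` class at `p`: if `u ≥ -1` a.e. and
`∫ |u|^α p dμ < ∞`, then `(1+u) log (1+u)` is `(p·μ)`-integrable. -/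
theorem Lalpha_subset_xlogx
    {X : Type*} [MeasurableSpace X] (μ : Measure X) (p u : X → ℝ)
    (hp : Measurable p) (hp_pos : ∀ᵐ x ∂μ, 0 < p x) (hp_one : ∫ x, p x ∂μ = 1)
    (hu : Measurable u) (α : ℝ) (hα : 1 < α)
    (hub : ∀ᵐ x ∂(μ.withDensity fun x => ENNReal.ofReal (p x)), -1 ≤ u x)
    (hmom : (∫⁻ x, ENNReal.ofReal (|u x| ^ α * p x) ∂μ) < ⊤) :
    (∫⁻ x, ENNReal.ofReal (|(1 + u x) * Real.log (1 + u x)| * p x) ∂μ) < ⊤ := by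
  have hp_int : Integrable p μ := .of_integral_ne_zero (by simp [hp_one])
  set C : ℝ := 1 + 2 ^ α / (α - 1)
  have hC0 : 0 ≤ C := by
    have := sub_pos.2 hα
    positivity
  calc ∫⁻ x, ENNReal.ofReal (|(1 + u x) * Real.log (1 + u x)| * p x) ∂μ
      ≤ ∫⁻ x, ENNReal.ofReal C *
          (ENNReal.ofReal (p x) + ENNReal.ofReal (|u x| ^ α * p x)) ∂μ := by
        refine lintegral_mono_ae ?_
        filter_upwards [hp_pos] with x hx
        rw [← ENNReal.ofReal_add hx.le (by positivity), ← ENNReal.ofReal_mul hC0]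
        apply ENNReal.ofReal_le_ofReal
        calc |(1 + u x) * Real.log (1 + u x)| * p x ≤ C * (1 + |u x| ^ α) * p x := by
              gcongr
              exact abs_one_add_mul_log_le hα (u x)
          _ = C * (p x + |u x| ^ α * p x) := by ring
    _ = ENNReal.ofReal C *
          (∫⁻ x, ENNReal.ofReal (p x) ∂μ + ∫⁻ x, ENNReal.ofReal (|u x| ^ α * p x) ∂μ) := by
        rw [lintegral_const_mul' _ _ ENNReal.ofReal_ne_top, lintegral_add_left hp.ennreal_ofReal]
    _ < ⊤ := ENNReal.mul_lt_top ENNReal.ofReal_lt_top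
        (ENNReal.add_lt_top.2 ⟨hp_int.lintegral_lt_top, hmom⟩)
end

section
/- If u and k are measurable functions such that ∫ e^{t|u|} p dμ < ∞ for some t > 0 and ∫ (1 + |k|) log(1 + |k|) p dμ < ∞, then the product u·k is (p·μ)-integrable, i.e. ∫ |u k| p dμ < ∞. -/
open MeasureTheory

/-- Young's inequality for the conjugate pair `exp` and `x log x - x`. -/
theorem mul_le_exp_add_mul_log_sub {a b : ℝ} (hb : 0 < b) :
    a * b ≤ Real.exp a + (b * Real.log b - b) := by
  have h := mul_le_mul_of_nonneg_right (Real.add_one_le_exp (a - Real.log b)) hb.le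
  rw [Real.exp_sub, Real.exp_log hb, div_mul_cancel₀ _ hb.ne'] at h
  linarith

/-- Duality pairing between the exponential Orlicz class and the `x log x` class: if `u` has
some exponential moment under `p·μ` and `k` is in the `x log x` class, then `u·k` is
`(p·μ)`-integrable. -/
theorem exp_xlogx_duality
    {X : Type*} [MeasurableSpace X] (μ : Measure X) (p u k : X → ℝ)
    (hp : Measurable p) (hp_pos : ∀ᵐ x ∂μ, 0 < p x) (hp_one : ∫ x, p x ∂μ = 1)
    (hu : Measurable u) (hk : Measurable k)
    (hexp : ∃ t > (0 : ℝ),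
      (∫⁻ x, ENNReal.ofReal (Real.exp (t * |u x|) * p x) ∂μ) < ⊤)
    (hxlogx : (∫⁻ x, ENNReal.ofReal ((1 + |k x|) * Real.log (1 + |k x|) * p x) ∂μ) < ⊤) :
    (∫⁻ x, ENNReal.ofReal (|u x * k x| * p x) ∂μ) < ⊤ := by
  obtain ⟨t, ht, hexp⟩ := hexp
  have hbound : ∀ᵐ x ∂μ, ENNReal.ofReal (|u x * k x| * p x) ≤
      ENNReal.ofReal t⁻¹ * (ENNReal.ofReal (Real.exp (t * |u x|) * p x) +
        ENNReal.ofReal ((1 + |k x|) * Real.log (1 + |k x|) * p x)) := by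
    filter_upwards [hp_pos] with x hx
    have hlog : 0 ≤ Real.log (1 + |k x|) := Real.log_nonneg (by simp)
    rw [← ENNReal.ofReal_add (by positivity) (by positivity),
      ← ENNReal.ofReal_mul (by positivity), ← add_mul, ← mul_assoc]
    refine ENNReal.ofReal_le_ofReal (mul_le_mul_of_nonneg_right ?_ hx.le)
    rw [abs_mul, le_inv_mul_iff₀ ht]
    have hY := mul_le_exp_add_mul_log_sub (a := t * |u x|)
      (show 0 < 1 + |k x| by positivity)
    have hu_nonneg : 0 ≤ t * |u x| := by positivity
    linarith [abs_nonneg (k x)]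
  refine (lintegral_mono_ae hbound).trans_lt ?_
  rw [lintegral_const_mul' _ _ ENNReal.ofReal_ne_top, lintegral_add_left (by fun_prop)]
  exact ENNReal.mul_lt_top ENNReal.ofReal_lt_top (ENNReal.add_lt_top.2 ⟨hexp, hxlogx⟩)
end

section
/- First differential of the cumulant generating functional: let u, v be measurable and suppose there is ε > 0 such that ∫ e^{u + t v} p dμ < ∞ for all |t| ≤ ε. Set K_p(u) = log ∫ e^{u} p dμ and q = e^{u − K_p(u)} p. Then the function g(t) = log ∫ e^{u + t v} p dμ is differentiable at t = 0 with g′(0) = ∫ v q dμ, i.e. the differential of K_p at u in the direction v is the mean of v under q. -/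
open MeasureTheory

open ProbabilityTheory in
/-- If the moment generating function of `v` under the measure of density `f` is finite near `0`,
then the logarithm of `t ↦ ∫ e^{t v} f dμ` is differentiable at `0`. -/
theorem hasDerivAt_log_integral_exp_mul_zero
    {X : Type*} [MeasurableSpace X] {μ : Measure X} {f v : X → ℝ}
    (hf : Measurable f) (hf_nonneg : 0 ≤ᵐ[μ] f) (hf_ne : ∫ x, f x ∂μ ≠ 0)
    {ε : ℝ} (hε : 0 < ε)
    (hint : ∀ t : ℝ, |t| ≤ ε → Integrable (fun x => Real.exp (t * v x) * f x) μ) :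
    HasDerivAt (fun t : ℝ => Real.log (∫ x, Real.exp (t * v x) * f x ∂μ))
      ((∫ x, v x * f x ∂μ) / ∫ x, f x ∂μ) 0 := by
  set ν := μ.withDensity fun x => ENNReal.ofReal (f x) with hν
  have hfm : Measurable fun x => ENNReal.ofReal (f x) := hf.ennreal_ofReal
  have hfin : ∀ᵐ x ∂μ, ENNReal.ofReal (f x) < ⊤ := by simp
  have hsmul (g : X → ℝ) :
      (fun x => (ENNReal.ofReal (f x)).toReal • g x) =ᵐ[μ] fun x => g x * f x := by
    filter_upwards [hf_nonneg] with x hx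
    rw [ENNReal.toReal_ofReal hx, smul_eq_mul, mul_comm]
  have hintegral (g : X → ℝ) : ∫ x, g x ∂ν = ∫ x, g x * f x ∂μ := by
    rw [hν, integral_withDensity_eq_integral_toReal_smul hfm hfin]
    exact integral_congr_ae (hsmul g)
  have hmgf : mgf v ν = fun t => ∫ x, Real.exp (t * v x) * f x ∂μ :=
    funext fun t => hintegral _
  have hmem : (0 : ℝ) ∈ interior (integrableExpSet v ν) := by
    rw [mem_interior_iff_mem_nhds]
    filter_upwards [Metric.closedBall_mem_nhds (0 : ℝ) hε] with t ht
    change Integrable (fun x => Real.exp (t * v x)) ν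
    rw [hν, integrable_withDensity_iff_integrable_smul' hfm hfin, integrable_congr (hsmul _)]
    exact hint t (by simpa using ht)
  have hderiv := hasDerivAt_mgf hmem
  rw [hintegral, hmgf] at hderiv
  simpa using hderiv.log (by simpa using hf_ne)

/-- First differential of the cumulant generating functional: the derivative at `t = 0` of
`t ↦ log ∫ e^{u + t v} p dμ` is the mean of `v` under `q = e^{u - K_p(u)} p`. -/
theorem cgf_first_differential
    {X : Type*} [MeasurableSpace X] (μ : Measure X) (p u v : X → ℝ)
    (hp : Measurable p) (hp_pos : ∀ᵐ x ∂μ, 0 < p x) (hp_one : ∫ x, p x ∂μ = 1)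
    (hu : Measurable u) (hv : Measurable v)
    (ε : ℝ) (hε : 0 < ε)
    (hint : ∀ t : ℝ, |t| ≤ ε → Integrable (fun x => Real.exp (u x + t * v x) * p x) μ)
    (K : ℝ) (hK : K = Real.log (∫ x, Real.exp (u x) * p x ∂μ))
    (q : X → ℝ) (hq : ∀ x, q x = Real.exp (u x - K) * p x) :
    HasDerivAt (fun t : ℝ => Real.log (∫ x, Real.exp (u x + t * v x) * p x ∂μ))
      (∫ x, v x * q x ∂μ) 0 := by
  have hf (t : ℝ) (x : X) :
      Real.exp (u x + t * v x) * p x = Real.exp (t * v x) * (Real.exp (u x) * p x) := by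
    rw [Real.exp_add]
    ring
  have hpos : 0 < ∫ x, Real.exp (u x) * p x ∂μ := by
    have hμ : μ ≠ 0 := by
      rintro rfl
      simp at hp_one
    have hfi : Integrable (fun x => Real.exp (u x) * p x) μ := by
      simpa using hint 0 (by simpa using hε.le)
    have hf_pos : ∀ᵐ x ∂μ, 0 < Real.exp (u x) * p x := by
      filter_upwards [hp_pos] with x hx
      positivity
    refine (integral_pos_iff_support_of_nonneg_ae (hf_pos.mono fun x hx => hx.le) hfi).2 ?_
    rw [measure_congr (t := Set.univ) (by
      filter_upwards [hf_pos] with x hx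
      exact propext ⟨fun _ => trivial, fun _ => hx.ne'⟩)]
    exact Measure.measure_univ_pos.2 hμ
  have hq_eq (x : X) :
      v x * q x = v x * (Real.exp (u x) * p x) / ∫ x, Real.exp (u x) * p x ∂μ := by
    rw [hq, hK, Real.exp_sub, Real.exp_log hpos]
    ring
  simp only [hf] at hint
  simp only [hf, hq_eq, integral_div]
  refine hasDerivAt_log_integral_exp_mul_zero (by fun_prop) ?_ hpos.ne' hε hint
  filter_upwards [hp_pos] with x hx
  exact mul_nonneg (Real.exp_pos _).le hx.le
end

section
/- Affine change of coordinates between exponential charts: let p₁, p₂ be probability densities with respect to μ, both μ-a.e. positive. Let u be measurable with ∫ u p₁ dμ = 0 and ∫ e^{u} p₁ dμ < ∞, and set q = e^{u − K₁} p₁ with K₁ = log ∫ e^{u} p₁ dμ. If the function u + log(p₁/p₂) is (p₂·μ)-integrable, then (p₂·μ)-a.e. one has log(q/p₂) − ∫ log(q/p₂) p₂ dμ = u + log(p₁/p₂) − ∫ (u + log(p₁/p₂)) p₂ dμ; in particular the change of coordinates s_{p₂} ∘ e_{p₁} is an affine map. -/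
open MeasureTheory

/-- The change of coordinates `s_{p₂} ∘ e_{p₁}` between exponential charts is affine:
for `q = e^{u - K₁} p₁`, `(p₂·μ)`-a.e. one has
`log (q/p₂) - E_{p₂} log (q/p₂) = u + log (p₁/p₂) - E_{p₂}[u + log (p₁/p₂)]`. -/
theorem change_of_coordinates_affine
    {X : Type*} [MeasurableSpace X] (μ : Measure X) (p₁ p₂ u : X → ℝ)
    (hp₁ : Measurable p₁) (hp₁_pos : ∀ᵐ x ∂μ, 0 < p₁ x) (hp₁_one : ∫ x, p₁ x ∂μ = 1)
    (hp₂ : Measurable p₂) (hp₂_pos : ∀ᵐ x ∂μ, 0 < p₂ x) (hp₂_one : ∫ x, p₂ x ∂μ = 1)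
    (hu : Measurable u)
    (hu_mean : ∫ x, u x * p₁ x ∂μ = 0)
    (hexp_int : Integrable (fun x => Real.exp (u x) * p₁ x) μ)
    (K₁ : ℝ) (hK₁ : K₁ = Real.log (∫ x, Real.exp (u x) * p₁ x ∂μ))
    (q : X → ℝ) (hq : ∀ x, q x = Real.exp (u x - K₁) * p₁ x)
    (hint : Integrable (fun x => (u x + Real.log (p₁ x / p₂ x)) * p₂ x) μ) :
    ∀ᵐ x ∂(μ.withDensity fun x => ENNReal.ofReal (p₂ x)),
      Real.log (q x / p₂ x) - ∫ y, Real.log (q y / p₂ y) * p₂ y ∂μ =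
      u x + Real.log (p₁ x / p₂ x) -
        ∫ y, (u y + Real.log (p₁ y / p₂ y)) * p₂ y ∂μ := by
  have hp₂_int : Integrable p₂ μ := by
    by_contra h
    simp [integral_undef h] at hp₂_one
  have hlog : ∀ᵐ x ∂μ,
      Real.log (q x / p₂ x) = u x + Real.log (p₁ x / p₂ x) - K₁ := by
    filter_upwards [hp₁_pos, hp₂_pos] with x h₁ h₂
    rw [hq, mul_div_assoc, Real.log_mul (Real.exp_ne_zero _) (div_pos h₁ h₂).ne', Real.log_exp]
    ring
  have hmean : ∫ y, Real.log (q y / p₂ y) * p₂ y ∂μ =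
      ∫ y, (u y + Real.log (p₁ y / p₂ y)) * p₂ y ∂μ - K₁ := by
    calc ∫ y, Real.log (q y / p₂ y) * p₂ y ∂μ
        = ∫ y, ((u y + Real.log (p₁ y / p₂ y)) * p₂ y - K₁ * p₂ y) ∂μ := by
          refine integral_congr_ae ?_
          filter_upwards [hlog] with y hy
          rw [hy, sub_mul]
      _ = ∫ y, (u y + Real.log (p₁ y / p₂ y)) * p₂ y ∂μ - K₁ := by
          rw [integral_sub hint (hp₂_int.const_mul K₁), integral_const_mul, hp₂_one, mul_one]
  filter_upwards [(withDensity_absolutelyContinuous μ _).ae_le hlog] with x hx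
  rw [hx, hmean]
  ring
end

section
/- If u is (p·μ)-integrable with ∫ u p dμ = 0 and ∫ e^{α u} p dμ < ∞ for some α > 1, and q = e^{u − K_p(u)} p with K_p(u) = log ∫ e^{u} p dμ, then (q/p) log(q/p) is (p·μ)-integrable, i.e. ∫ q |log(q/p)| dμ < ∞; in particular q/p − 1 belongs to the x log x class at p. -/
open MeasureTheory

theorem exp_mul_abs_le {α : ℝ} (hα : 1 < α) (v : ℝ) :
    Real.exp v * |v| ≤ (α - 1)⁻¹ * Real.exp (α * v) + 1 := by
  have hα' : 0 < α - 1 := sub_pos.2 hα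
  rcases le_total 0 v with hv | hv
  · have hlin : (α - 1) * v ≤ Real.exp ((α - 1) * v) := by
      linarith [Real.add_one_le_exp ((α - 1) * v)]
    have hsplit : Real.exp (α * v) = Real.exp v * Real.exp ((α - 1) * v) := by
      rw [← Real.exp_add]; ring_nf
    have hv_le : v ≤ (α - 1)⁻¹ * Real.exp ((α - 1) * v) := by
      rwa [inv_mul_eq_div, le_div_iff₀' hα']
    calc Real.exp v * |v| ≤ Real.exp v * ((α - 1)⁻¹ * Real.exp ((α - 1) * v)) := by
          rw [abs_of_nonneg hv]; gcongr
      _ = (α - 1)⁻¹ * Real.exp (α * v) := by rw [hsplit]; ring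
      _ ≤ _ := by linarith
  · have hlin : -v ≤ Real.exp (-v) := by linarith [Real.add_one_le_exp (-v)]
    calc Real.exp v * |v| ≤ Real.exp v * Real.exp (-v) := by
          rw [abs_of_nonpos hv]; gcongr
      _ = 1 := by rw [← Real.exp_add, add_neg_cancel, Real.exp_zero]
      _ ≤ _ := by linarith [mul_pos (inv_pos.2 hα') (Real.exp_pos (α * v))]

/-- If `u` is centered and `e^{αu}` is `(p·μ)`-integrable for some `α > 1`, then for
`q = e^{u - K_p(u)} p` the function `(q/p) log (q/p)` is `(p·μ)`-integrable; in particular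
`q/p - 1` belongs to the `x log x` class at `p`. -/
theorem density_ratio_in_xlogx
    {X : Type*} [MeasurableSpace X] (μ : Measure X) (p u : X → ℝ)
    (hp : Measurable p) (hp_pos : ∀ᵐ x ∂μ, 0 < p x) (hp_one : ∫ x, p x ∂μ = 1)
    (hu : Measurable u)
    (hu_int : Integrable (fun x => u x * p x) μ)
    (hu_mean : ∫ x, u x * p x ∂μ = 0)
    (hexp : ∃ α > (1 : ℝ), Integrable (fun x => Real.exp (α * u x) * p x) μ)
    (K : ℝ) (hK : K = Real.log (∫ x, Real.exp (u x) * p x ∂μ))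
    (q : X → ℝ) (hq : ∀ x, q x = Real.exp (u x - K) * p x) :
    (∫⁻ x, ENNReal.ofReal (q x * |Real.log (q x / p x)|) ∂μ) < ⊤ := by
  obtain ⟨α, hα, hα_int⟩ := hexp
  have hp_int : Integrable p μ := by
    by_contra h
    rw [integral_undef h] at hp_one
    exact zero_ne_one hp_one
  have hbound : Integrable (fun x => (α - 1)⁻¹ * Real.exp (-(α * K)) *
      (Real.exp (α * u x) * p x) + p x) μ := (hα_int.const_mul _).add hp_int
  refine lt_of_le_of_lt (lintegral_mono_ae ?_) hbound.lintegral_lt_top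
  filter_upwards [hp_pos] with x hx
  apply ENNReal.ofReal_le_ofReal
  have hsplit : Real.exp (α * (u x - K)) = Real.exp (-(α * K)) * Real.exp (α * u x) := by
    rw [← Real.exp_add]; ring_nf
  have hle := mul_le_mul_of_nonneg_right (exp_mul_abs_le hα (u x - K)) hx.le
  rw [hq x, mul_div_cancel_right₀ _ hx.ne', Real.log_exp]
  rw [hsplit] at hle
  linarith
end

section
/- Derivative of the square-root embedding: let u, v be measurable and suppose there is ε > 0 such that ∫ e^{2(u + t v)} p dμ < ∞ for all |t| ≤ ε. For |t| ≤ ε set K(t) = log ∫ e^{u + t v} p dμ and q_t = e^{u + t v − K(t)} p, and let H(t) = √(q_t) ∈ L²(μ). Then H is differentiable at t = 0 as a map into L²(μ), with derivative H′(0) = (1/2) √(q₀) (v − ∫ v q₀ dμ); moreover ‖H′(0)‖²_{L²(μ)} = (1/4)(∫ v² q₀ dμ − (∫ v q₀ dμ)²). -/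
open MeasureTheory Topology Filter

open ProbabilityTheory in
/-- If `exp (t * v)` is integrable for `t` near `0`, the cumulant generating function of `v` has
derivative `Q[v]` at `0`. -/
lemma hasDerivAt_cgf_zero_of_mem_interior {X : Type*} [MeasurableSpace X] {Q : Measure X}
    [IsProbabilityMeasure Q] {v : X → ℝ} (h : 0 ∈ interior (integrableExpSet v Q)) :
    HasDerivAt (cgf v Q) (∫ x, v x ∂Q) 0 := by
  have h₁ := (analyticAt_cgf h).differentiableAt.hasDerivAt
  rw [deriv_cgf h] at h₁
  simpa using h₁

lemma abs_exp_sub_one_le_mul_exp (y : ℝ) : |Real.exp y - 1| ≤ |y| * Real.exp |y| := by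
  rcases le_total 0 y with hy | hy
  · rw [abs_of_nonneg (by simpa using hy), abs_of_nonneg hy]
    have h₁ := Real.add_one_le_exp (-y)
    have h₂ : Real.exp y * Real.exp (-y) = 1 := by rw [← Real.exp_add]; simp
    nlinarith [Real.exp_pos y]
  · rw [abs_of_nonpos (by simpa using hy), abs_of_nonpos hy]
    have h₁ := Real.add_one_le_exp y
    have h₂ : 1 ≤ Real.exp (-y) := Real.one_le_exp (by linarith)
    nlinarith

/-- Pointwise form of the derivative of `t ↦ exp ((t * a - c t) / 2)` at `0`. -/
lemma tendsto_exp_half_slope {c : ℝ → ℝ} {m : ℝ} (hc : HasDerivAt c m 0) (hc₀ : c 0 = 0) (a : ℝ) :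
    Tendsto (fun t ↦ (Real.exp ((t * a - c t) / 2) - 1) / t) (𝓝[≠] 0) (𝓝 ((a - m) / 2)) := by
  have h : HasDerivAt (fun t ↦ Real.exp ((t * a - c t) / 2)) ((a - m) / 2) 0 := by
    simpa [hc₀] using ((((hasDerivAt_id (0 : ℝ)).mul_const a).sub hc).div_const 2).exp
  have h₁ := h.tendsto_slope
  refine h₁.congr fun t ↦ ?_
  simp [slope_def_field, hc₀]

/-- Domination of the error in the derivative of `t ↦ exp ((t * a - c) / 2)`. -/
lemma exp_half_slope_sub_sq_le {a c m t C δ : ℝ} (ht : t ≠ 0) (htδ : |t| ≤ δ) (hm : |m| ≤ C)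
    (hc : |c / t| ≤ C) :
    ((Real.exp ((t * a - c) / 2) - 1) / t - (a - m) / 2) ^ 2
      ≤ (|a| + C) ^ 2 * Real.exp (δ * (|a| + C)) := by
  set y := (t * a - c) / 2 with hy
  have hC : 0 ≤ C := (abs_nonneg m).trans hm
  have hS : 0 ≤ |a| + C := by positivity
  have hδ : 0 ≤ δ := (abs_nonneg t).trans htδ
  have hyt : |y| = |t| * (|a - c / t| / 2) := by
    rw [hy, show (t * a - c) / 2 = t * ((a - c / t) / 2) by field_simp, abs_mul, abs_div]
    simp
  have h₁ : |a - c / t| ≤ |a| + C := (abs_sub _ _).trans (by gcongr)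
  have h₂ : |a - m| ≤ |a| + C := (abs_sub _ _).trans (by gcongr)
  have hyδ : |y| ≤ δ * (|a| + C) / 2 := by
    rw [hyt, mul_div_assoc]
    gcongr
  have hE : 1 ≤ Real.exp (δ * (|a| + C) / 2) := Real.one_le_exp (by positivity)
  have h₃ : |(Real.exp y - 1) / t| ≤ (|a| + C) / 2 * Real.exp (δ * (|a| + C) / 2) := by
    rw [abs_div, div_le_iff₀ (abs_pos.mpr ht)]
    calc |Real.exp y - 1| ≤ |y| * Real.exp |y| := abs_exp_sub_one_le_mul_exp y
      _ ≤ (|t| * ((|a| + C) / 2)) * Real.exp (δ * (|a| + C) / 2) := by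
        gcongr
        rw [hyt]
        gcongr
      _ = _ := by ring
  have h₄ : |(Real.exp y - 1) / t - (a - m) / 2|
      ≤ (|a| + C) * Real.exp (δ * (|a| + C) / 2) := by
    refine (abs_sub _ _).trans ?_
    rw [abs_div (a - m) 2, abs_two]
    nlinarith
  calc _ = |(Real.exp y - 1) / t - (a - m) / 2| ^ 2 := (sq_abs _).symm
    _ ≤ ((|a| + C) * Real.exp (δ * (|a| + C) / 2)) ^ 2 := by gcongr
    _ = _ := by
      rw [mul_pow, ← Real.exp_nat_mul]
      congr 2
      push_cast
      ring

open ProbabilityTheory in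
/-- The square-root embedding of the exponential family generated by `v` is differentiable in
mean square at the base measure `Q`. -/
lemma tendsto_integral_exp_half_slope_sub_sq {X : Type*} [MeasurableSpace X] {Q : Measure X}
    [IsProbabilityMeasure Q] {v : X → ℝ} (hv : Measurable v) {ε : ℝ} (hε : 0 < ε)
    (hint : ∀ t, |t| ≤ ε → Integrable (fun x ↦ Real.exp (t * v x)) Q) :
    Tendsto (fun t ↦ ∫ x, ((Real.exp ((t * v x - cgf v Q t) / 2) - 1) / t
      - (v x - ∫ x, v x ∂Q) / 2) ^ 2 ∂Q) (𝓝[≠] 0) (𝓝 0) := by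
  set m := ∫ x, v x ∂Q
  have h₀ : 0 ∈ interior (integrableExpSet v Q) := by
    rw [mem_interior_iff_mem_nhds]
    filter_upwards [Metric.closedBall_mem_nhds (0 : ℝ) hε] with t ht
    exact hint t (by simpa using ht)
  have hc := hasDerivAt_cgf_zero_of_mem_interior h₀
  have hc₀ : cgf v Q 0 = 0 := cgf_zero
  have hbdd : ∀ᶠ t in 𝓝[≠] (0 : ℝ), |cgf v Q t / t| ≤ |m| + 1 := by
    have h₁ : Tendsto (fun t ↦ |cgf v Q t / t|) (𝓝[≠] 0) (𝓝 |m|) := by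
      refine (hc.tendsto_slope.congr fun t ↦ ?_).abs
      simp [slope_def_field]
    exact (h₁.eventually_lt_const (lt_add_one _)).mono fun _ h ↦ h.le
  have hsmall : ∀ᶠ t in 𝓝[≠] (0 : ℝ), |t| ≤ ε / 2 := by
    refine nhdsWithin_le_nhds ?_
    filter_upwards [Metric.closedBall_mem_nhds (0 : ℝ) (half_pos hε)] with t ht
    simpa using ht
  rw [show 𝓝 (0 : ℝ) = 𝓝 (∫ _, (0 : ℝ) ∂Q) by rw [integral_zero]]
  refine tendsto_integral_filter_of_dominated_convergence
    (fun x ↦ (|v x| + (|m| + 1)) ^ 2 * Real.exp (ε / 2 * (|v x| + (|m| + 1)))) ?_ ?_ ?_ ?_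
  · exact Eventually.of_forall fun t ↦ by fun_prop
  · filter_upwards [hbdd, hsmall, self_mem_nhdsWithin] with t h₁ h₂ h₃
    refine ae_of_all _ fun x ↦ ?_
    rw [Real.norm_of_nonneg (sq_nonneg _)]
    exact exp_half_slope_sub_sq_le h₃ h₂ (by linarith) h₁
  · have hmom (n : ℕ) : Integrable (fun x ↦ |v x| ^ n * Real.exp (ε / 2 * |v x|)) Q := by
      have := integrable_pow_abs_mul_exp_add_of_integrable_exp_mul (X := v) (μ := Q) (v := 0)
        (t := ε) (x := ε / 2) (by simpa using hint ε (abs_of_pos hε).le)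
        (by simpa using hint (-ε) (by simp [abs_of_pos hε])) (by positivity)
        (by rw [abs_of_pos hε]; linarith) n
      simpa using this
    have := (((hmom 2).add ((hmom 1).const_mul (2 * (|m| + 1)))).add
      ((hmom 0).const_mul ((|m| + 1) ^ 2))).mul_const (Real.exp (ε / 2 * (|m| + 1)))
    refine this.congr (ae_of_all _ fun x ↦ ?_)
    simp only [Pi.add_apply, mul_add, Real.exp_add]
    ring
  · refine ae_of_all _ fun x ↦ ?_
    have := ((tendsto_exp_half_slope hc hc₀ (v x)).sub_const ((v x - m) / 2)).pow 2
    simpa [m] using this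

open MeasureTheory Topology Filter

/-- Derivative of the square-root embedding: `t ↦ √(q_t)` is differentiable at `t = 0` as a
map into `L²(μ)`, with derivative `(1/2)√(q₀)(v - E_{q₀} v)`, whose squared `L²` norm is a
quarter of the variance of `v` under `q₀`. -/
theorem sqrt_embedding_derivative
    {X : Type*} [MeasurableSpace X] (μ : Measure X) (p u v : X → ℝ)
    (hp : Measurable p) (hp_pos : ∀ᵐ x ∂μ, 0 < p x) (hp_one : ∫ x, p x ∂μ = 1)
    (hu : Measurable u) (hv : Measurable v)
    (ε : ℝ) (hε : 0 < ε)
    (hint : ∀ t : ℝ, |t| ≤ ε →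
      (∫⁻ x, ENNReal.ofReal (Real.exp (2 * (u x + t * v x)) * p x) ∂μ) < ⊤)
    (K : ℝ → ℝ) (hK : ∀ t, K t = Real.log (∫ x, Real.exp (u x + t * v x) * p x ∂μ))
    (q : ℝ → X → ℝ) (hq : ∀ t x, q t x = Real.exp (u x + t * v x - K t) * p x)
    (m : ℝ) (hm : m = ∫ x, v x * q 0 x ∂μ)
    (D : X → ℝ) (hD : ∀ x, D x = (1 / 2) * Real.sqrt (q 0 x) * (v x - m)) :
    Tendsto
      (fun t : ℝ =>
        ∫ x, ((Real.sqrt (q t x) - Real.sqrt (q 0 x)) / t - D x) ^ 2 ∂μ)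
      (𝓝[≠] (0 : ℝ)) (𝓝 0) ∧
    ∫ x, (D x) ^ 2 ∂μ =
      (1 / 4) * ((∫ x, (v x) ^ 2 * q 0 x ∂μ) - (∫ x, v x * q 0 x ∂μ) ^ 2) := by
  have hexp_int (t : ℝ) (ht : |t| ≤ ε) :
      Integrable (fun x ↦ Real.exp (u x + t * v x) * p x) μ := by
    have hp_int : Integrable p μ := by
      by_contra h
      simp [integral_undef h] at hp_one
    have h₂ : Integrable (fun x ↦ Real.exp (2 * (u x + t * v x)) * p x) μ := by
      refine (lintegral_ofReal_ne_top_iff_integrable (by fun_prop) ?_).mp (hint t ht).ne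
      filter_upwards [hp_pos] with x hx
      positivity
    refine (hp_int.add h₂).mono' (by fun_prop) ?_
    filter_upwards [hp_pos] with x hx
    rw [Real.norm_of_nonneg (by positivity), Pi.add_apply, two_mul, Real.exp_add (u x + t * v x)]
    nlinarith [sq_nonneg (Real.exp (u x + t * v x) - 1), Real.exp_pos (u x + t * v x),
      mul_pos (Real.exp_pos (u x + t * v x)) hx, mul_nonneg hx.le
        (sq_nonneg (Real.exp (u x + t * v x) - 1))]
  have hμ : μ ≠ 0 := by
    rintro rfl
    simp at hp_one
  have hZ_pos (t : ℝ) (ht : |t| ≤ ε) : 0 < ∫ x, Real.exp (u x + t * v x) * p x ∂μ := by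
    have hpos : ∀ᵐ x ∂μ, 0 < Real.exp (u x + t * v x) * p x := by
      filter_upwards [hp_pos] with x hx
      positivity
    refine (integral_nonneg_of_ae (hpos.mono fun _ h ↦ h.le)).lt_of_ne' fun h ↦ hμ ?_
    have h' := (integral_eq_zero_iff_of_nonneg_ae (hpos.mono fun _ h ↦ h.le) (hexp_int t ht)).mp h
    rw [← ae_eq_bot, ← eventually_false_iff_eq_bot]
    filter_upwards [hpos, h'] with x h₁ h₂
    exact h₁.ne' h₂
  have h0 : |(0 : ℝ)| ≤ ε := by simpa using hε.le
  have hq_eq (t : ℝ) (x : X) : q t x = q 0 x * Real.exp (t * v x - (K t - K 0)) := by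
    rw [hq, hq, mul_right_comm, ← Real.exp_add]
    congr 2
    ring
  have hq_meas : Measurable (q 0) := by
    rw [show q 0 = fun x ↦ Real.exp (u x + 0 * v x - K 0) * p x from funext (hq 0)]
    fun_prop
  have hq_nonneg : ∀ᵐ x ∂μ, 0 ≤ q 0 x := by
    filter_upwards [hp_pos] with x hx
    rw [hq]
    positivity
  set Q := μ.withDensity (fun x ↦ ENNReal.ofReal (q 0 x)) with hQ
  have hQ_integral (f : X → ℝ) : ∫ x, f x ∂Q = ∫ x, f x * q 0 x ∂μ := by
    rw [hQ, integral_withDensity_eq_integral_toReal_smul (by fun_prop) (by simp)]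
    refine integral_congr_ae ?_
    filter_upwards [hq_nonneg] with x hx
    rw [ENNReal.toReal_ofReal hx, smul_eq_mul, mul_comm]
  have htilt (t : ℝ) (x : X) : Real.exp (t * v x) * q 0 x
      = Real.exp (-K 0) * (Real.exp (u x + t * v x) * p x) := by
    rw [hq, ← mul_assoc, ← mul_assoc, ← Real.exp_add, ← Real.exp_add]
    congr 2
    ring
  have hQ_int (t : ℝ) (ht : |t| ≤ ε) : Integrable (fun x ↦ Real.exp (t * v x)) Q := by
    rw [hQ, integrable_withDensity_iff (by fun_prop) (by simp)]
    refine ((hexp_int t ht).const_mul (Real.exp (-K 0))).congr ?_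
    filter_upwards [hq_nonneg] with x hx
    rw [ENNReal.toReal_ofReal hx, htilt]
  have hmgf (t : ℝ) (ht : |t| ≤ ε) : ProbabilityTheory.mgf v Q t = Real.exp (K t - K 0) := by
    rw [ProbabilityTheory.mgf, hQ_integral]
    simp_rw [htilt]
    rw [integral_const_mul, sub_eq_neg_add, Real.exp_add, hK t, Real.exp_log (hZ_pos t ht)]
  have hQ_fin : IsFiniteMeasure Q := by
    have h := hQ_int 0 h0
    simp only [zero_mul, Real.exp_zero] at h
    exact (integrable_const_iff_isFiniteMeasure one_ne_zero).mp h
  have hQ_prob : IsProbabilityMeasure Q := by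
    have h := hmgf 0 h0
    rw [ProbabilityTheory.mgf_zero', sub_self, Real.exp_zero] at h
    exact ⟨by simpa [Measure.real, ENNReal.toReal_eq_one_iff] using h⟩
  have hcgf (t : ℝ) (ht : |t| ≤ ε) : ProbabilityTheory.cgf v Q t = K t - K 0 := by
    rw [ProbabilityTheory.cgf, hmgf t ht, Real.log_exp]
  have hmQ : m = ∫ x, v x ∂Q := by rw [hm, hQ_integral]
  have hsqrt {t x : _} (hx : 0 ≤ q 0 x) : Real.sqrt (q t x)
      = Real.sqrt (q 0 x) * Real.exp ((t * v x - (K t - K 0)) / 2) := by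
    rw [hq_eq t, Real.sqrt_mul hx, Real.exp_half]
  constructor
  · refine (tendsto_integral_exp_half_slope_sub_sq hv hε hQ_int).congr' ?_
    have hsmall : ∀ᶠ t in 𝓝[≠] (0 : ℝ), |t| ≤ ε := by
      refine nhdsWithin_le_nhds ?_
      filter_upwards [Metric.closedBall_mem_nhds (0 : ℝ) hε] with t ht
      simpa using ht
    filter_upwards [hsmall] with t ht
    rw [hQ_integral, hcgf t ht, ← hmQ]
    refine integral_congr_ae ?_
    filter_upwards [hq_nonneg] with x hx
    rw [hsqrt (t := t) hx, hD]
    nth_rw 1 [← Real.sq_sqrt hx]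
    ring
  · have hvar := ProbabilityTheory.variance_eq_sub (μ := Q) (X := v) <|
      ProbabilityTheory.memLp_of_mem_interior_integrableExpSet (by
        rw [mem_interior_iff_mem_nhds]
        filter_upwards [Metric.closedBall_mem_nhds (0 : ℝ) hε] with t ht
        exact hQ_int t (by simpa using ht)) 2
    rw [ProbabilityTheory.variance_eq_integral hv.aemeasurable, ← hmQ] at hvar
    simp only [Pi.pow_apply] at hvar
    rw [hQ_integral, hQ_integral (fun x ↦ v x ^ 2), hm] at hvar
    rw [← hvar, ← hm, ← integral_const_mul]
    refine integral_congr_ae ?_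
    filter_upwards [hq_nonneg] with x hx
    rw [hD, mul_pow, mul_pow, Real.sq_sqrt hx]
    ring
end

section
/- Nonlinear diffusions with unit-variance Gaussian law: let k ∈ ℝ and let a : [0,∞) × ℝ → ℝ be such that x ↦ a(t,x) is C² for each t. Define the drift f(t,x) = (1/2)∂_x a(t,x) + (1/2) a(t,x)(k t − x) + k and the density p(t,x) = (2π)^{−1/2} exp(−(x − k t)²/2). Then for all t ≥ 0 and x ∈ ℝ: ∂_t p(t,x) = −∂_x( f(t,x) p(t,x) ) + (1/2) ∂²_{xx}( a(t,x) p(t,x) ); i.e. the Gaussian density with mean kt and variance 1 solves the Fokker–Planck equation for every choice of diffusion coefficient a. -/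
/-- The derivative of the unit-variance Gaussian density in its space variable. -/
lemma hasDerivAt_gaussian_space (m x : ℝ) :
    HasDerivAt (fun y => (Real.sqrt (2 * Real.pi))⁻¹ * Real.exp (-(y - m) ^ 2 / 2))
      (-(x - m) * ((Real.sqrt (2 * Real.pi))⁻¹ * Real.exp (-(x - m) ^ 2 / 2))) x := by
  have h := (((((hasDerivAt_id' x).sub_const m).fun_pow 2).fun_neg.div_const 2).exp).const_mul
    (Real.sqrt (2 * Real.pi))⁻¹
  refine h.congr_deriv ?_
  push_cast
  ring

/-- The time derivative of the unit-variance Gaussian density whose mean moves at speed `k`. -/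
lemma hasDerivAt_gaussian_time (k x t : ℝ) :
    HasDerivAt (fun s => (Real.sqrt (2 * Real.pi))⁻¹ * Real.exp (-(x - k * s) ^ 2 / 2))
      (k * (x - k * t) * ((Real.sqrt (2 * Real.pi))⁻¹ * Real.exp (-(x - k * t) ^ 2 / 2))) t := by
  have h := ((((((hasDerivAt_id' t).const_mul k).const_sub x).fun_pow 2).fun_neg.div_const
    2).exp).const_mul (Real.sqrt (2 * Real.pi))⁻¹
  refine h.congr_deriv ?_
  push_cast
  ring

/-- Nonlinear diffusions with unit-variance Gaussian law: with drift
`f(t,x) = (1/2)∂ₓa(t,x) + (1/2)a(t,x)(kt - x) + k`, the Gaussian density with mean `kt` and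
variance `1` solves the Fokker–Planck equation for every diffusion coefficient `a`. -/
theorem gaussian_unit_variance_solves_fokker_planck
    (k : ℝ) (a : ℝ → ℝ → ℝ) (ha : ∀ t, ContDiff ℝ 2 (a t))
    (f : ℝ → ℝ → ℝ)
    (hf : ∀ t x, f t x =
      (1 / 2) * deriv (a t) x + (1 / 2) * a t x * (k * t - x) + k)
    (p : ℝ → ℝ → ℝ)
    (hp : ∀ t x, p t x = (Real.sqrt (2 * Real.pi))⁻¹ *
      Real.exp (-(x - k * t) ^ 2 / 2)) :
    ∀ t, 0 ≤ t → ∀ x : ℝ,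
      deriv (fun s => p s x) t =
        -(deriv (fun y => f t y * p t y) x) +
          (1 / 2) * deriv (deriv (fun y => a t y * p t y)) x := by
  intro t _ x
  obtain rfl : p = fun s y => (Real.sqrt (2 * Real.pi))⁻¹ * Real.exp (-(y - k * s) ^ 2 / 2) :=
    funext₂ hp
  obtain rfl : f = fun t x => (1 / 2) * deriv (a t) x + (1 / 2) * a t x * (k * t - x) + k :=
    funext₂ hf
  have hda : Differentiable ℝ (a t) := (ha t).differentiable two_ne_zero
  have hdda : Differentiable ℝ (deriv (a t)) := (ha t).differentiable_deriv_two
  beta_reduce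
  have hpx := hasDerivAt_gaussian_space (k * t)
  have hflux : deriv (fun y => a t y * ((Real.sqrt (2 * Real.pi))⁻¹ *
        Real.exp (-(y - k * t) ^ 2 / 2))) =
      fun y => 2 * (((1 / 2) * deriv (a t) y + (1 / 2) * a t y * (k * t - y) + k) *
          ((Real.sqrt (2 * Real.pi))⁻¹ * Real.exp (-(y - k * t) ^ 2 / 2)) -
        k * ((Real.sqrt (2 * Real.pi))⁻¹ * Real.exp (-(y - k * t) ^ 2 / 2))) := by
    funext y
    rw [((hda y).hasDerivAt.fun_mul (hpx y)).deriv]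
    ring
  have hdrift : DifferentiableAt ℝ
      (fun y => ((1 / 2) * deriv (a t) y + (1 / 2) * a t y * (k * t - y) + k) *
        ((Real.sqrt (2 * Real.pi))⁻¹ * Real.exp (-(y - k * t) ^ 2 / 2))) x := by
    fun_prop
  rw [(hasDerivAt_gaussian_time k x t).deriv, hflux,
    ((hdrift.hasDerivAt.fun_sub ((hpx x).const_mul k)).const_mul 2).deriv]
  ring
end
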